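/- Fix an integer N ≥ 2 and let Ω = (0,1)³ ⊂ ℝ³. For each m let M_m be a positive integer multiple of N with M_m → ∞, set ε_m = 1/M_m, let {Q_i : i = 1,…,M_m³} be the open subcubes of side ε_m partitioning Ω (up to a null set), with centers x^i, and set A^{ij} = 1 if x^i − x^j ∈ Nε_m ℤ³ \ {0} and A^{ij} = 0 otherwise. Define φ_m(x,y) = Σ_{i,j} A^{ij} 1_{Q_i}(x) 1_{Q_j}(y). Then φ_m converges weak-* in L∞(Ω×Ω) to the constant function 1/N³, i.e. ∫∫ φ_m(x,y) f(x,y) dx dy → (1/N³) ∫∫ f(x,y) dx dy for every f ∈ L¹(Ω×Ω). -/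

import Mathlib

open MeasureTheory Filter Topology Classical

/-- Translation is continuous in `L¹`. -/
theorem tendsto_integral_norm_translate_sub {G : Type*} [NormedAddCommGroup G]
    [MeasurableSpace G] [BorelSpace G] {μ : Measure G} [IsLocallyFiniteMeasure μ]
    [μ.InnerRegularCompactLTTop] [μ.IsAddLeftInvariant] {f : G → ℝ} (hf : Integrable f μ) :
    Tendsto (fun c : G => ∫ p, ‖f (c + p) - f p‖ ∂μ) (𝓝 0) (𝓝 0) := by
  have hp : Fact ((1 : ENNReal) ≠ ⊤) := ⟨ENNReal.one_ne_top⟩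
  have hf' : MemLp f 1 μ := memLp_one_iff_integrable.mpr hf
  set F : Lp ℝ 1 μ := hf'.toLp f
  have hcont : Continuous fun c : G => ‖(DomAddAct.mk c +ᵥ F) - F‖ := by
    have : Continuous fun c : G => DomAddAct.mk c :=
      DomAddAct.mkHomeomorph.continuous
    fun_prop
  have key : ∀ c : G, ‖(DomAddAct.mk c +ᵥ F) - F‖ = ∫ p, ‖f (c + p) - f p‖ ∂μ := by
    intro c
    rw [← dist_eq_norm, L1.dist_eq_integral_dist]
    have h1 : (DomAddAct.mk c +ᵥ F : Lp ℝ 1 μ) =ᵐ[μ] fun p => f (c + p) :=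
      MemLp.coeFn_toLp (hf'.comp_measurePreserving (measurePreserving_add_left μ c))
    have h2 : (F : G → ℝ) =ᵐ[μ] f := hf'.coeFn_toLp
    refine integral_congr_ae ?_
    filter_upwards [h1, h2] with p h1 h2
    rw [h1, h2, dist_eq_norm]
  have := hcont.tendsto 0
  simp only [key] at this
  simpa using this

/-- If finitely many infinitesimal translates of `g m` add up to `1`, then `g m` converges weak-*
to the reciprocal of the number of translates. -/
theorem tendsto_integral_mul_of_sum_translate_eq_one {G ι : Type*} [NormedAddCommGroup G]
    [MeasurableSpace G] [BorelSpace G] {μ : Measure G} [IsLocallyFiniteMeasure μ]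
    [μ.InnerRegularCompactLTTop] [μ.IsAddLeftInvariant] [Fintype ι] [Nonempty ι]
    {g : ℕ → G → ℝ} (hg : ∀ m, Measurable (g m)) (hg_le : ∀ m p, ‖g m p‖ ≤ 1)
    {c : ℕ → ι → G} (hc : ∀ k, Tendsto (fun m => c m k) atTop (𝓝 0))
    (hsum : ∀ m p, ∑ k, g m (c m k + p) = 1) {f : G → ℝ} (hf : Integrable f μ) :
    Tendsto (fun m => ∫ p, g m p * f p ∂μ) atTop
      (𝓝 ((Fintype.card ι : ℝ)⁻¹ * ∫ p, f p ∂μ)) := by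
  have hmul : ∀ (u : G → ℝ) (v : G → ℝ), Measurable u → (∀ p, ‖u p‖ ≤ 1) → Integrable v μ →
      Integrable (fun p => u p * v p) μ := fun u v hu hu' hv =>
    hv.bdd_mul hu.aestronglyMeasurable (ae_of_all _ hu')
  have hshift : ∀ b : G, Integrable (fun p => f (b + p)) μ := fun b => hf.comp_add_left b
  have hdiff : ∀ k, Tendsto (fun m => ∫ p, g m p * (f p - f (-c m k + p)) ∂μ) atTop (𝓝 0) := by
    intro k
    have hlim : Tendsto (fun m => ∫ p, ‖f (-c m k + p) - f p‖ ∂μ) atTop (𝓝 0) :=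
      (tendsto_integral_norm_translate_sub hf).comp (by simpa using (hc k).neg)
    refine squeeze_zero_norm (fun m => ?_) hlim
    refine norm_integral_le_of_norm_le ((hshift _).sub hf).norm (ae_of_all _ fun p => ?_)
    rw [norm_mul, norm_sub_rev]
    exact mul_le_of_le_one_left (norm_nonneg _) (hg_le m p)
  have hint : ∀ m, ∑ k, ∫ p, g m p * (f p - f (-c m k + p)) ∂μ
      = Fintype.card ι * ∫ p, g m p * f p ∂μ - ∫ p, f p ∂μ := by
    intro m
    have hk : ∀ k, ∫ p, g m p * (f p - f (-c m k + p)) ∂μ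
        = ∫ p, g m p * f p ∂μ - ∫ p, g m (c m k + p) * f p ∂μ := by
      intro k
      simp only [mul_sub]
      rw [integral_sub (hmul _ _ (hg m) (hg_le m) hf) (hmul _ _ (hg m) (hg_le m) (hshift _)),
        ← integral_add_left_eq_self (fun p => g m p * f (-c m k + p)) (c m k)]
      simp
    have hsum' : ∑ k, ∫ p, g m (c m k + p) * f p ∂μ = ∫ p, f p ∂μ := by
      rw [← integral_finsetSum _ fun k _ => hmul (fun p => g m (c m k + p)) f
        ((hg m).comp (measurable_const_add _)) (fun p => hg_le m _) hf]
      simp [← Finset.sum_mul, hsum]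
    simp [hk, Finset.sum_sub_distrib, hsum']
  have hlim : Tendsto (fun m => Fintype.card ι * ∫ p, g m p * f p ∂μ - ∫ p, f p ∂μ)
      atTop (𝓝 0) := by
    simp only [← hint]
    simpa using tendsto_finsetSum Finset.univ fun k _ => hdiff k
  have hcard : (Fintype.card ι : ℝ) ≠ 0 := by simp
  have := (hlim.add_const (∫ p, f p ∂μ)).const_mul (Fintype.card ι : ℝ)⁻¹
  simpa [hcard] using this

local notation "E³" => EuclideanSpace ℝ (Fin 3)

/-- The integer index of the cell of the cubic lattice of period `1 / M` that contains `x`. -/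
noncomputable def cellIndex (M : ℕ) (x : E³) : Fin 3 → ℤ := fun d => ⌊(M : ℝ) * x d⌋

theorem measurable_cellIndex (M : ℕ) : Measurable (cellIndex M) := by
  unfold cellIndex
  fun_prop

/-- The pairs of points whose cells lie in the same coset of the sublattice of period `N`. -/
def sameResidue (N M : ℕ) : Set (E³ × E³) :=
  {p | ∀ d, (cellIndex M p.1 d : ZMod N) = cellIndex M p.2 d}

/-- The pairs of points that lie in the same cell. -/
def sameCell (M : ℕ) : Set (E³ × E³) := {p | cellIndex M p.1 = cellIndex M p.2}

theorem measurableSet_of_cellIndex (M : ℕ) (P : (Fin 3 → ℤ) → (Fin 3 → ℤ) → Prop) :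
    MeasurableSet {p : E³ × E³ | P (cellIndex M p.1) (cellIndex M p.2)} :=
  (((measurable_cellIndex M).comp measurable_fst).prodMk
    ((measurable_cellIndex M).comp measurable_snd))
      (MeasurableSet.of_discrete (s := {q : (Fin 3 → ℤ) × (Fin 3 → ℤ) | P q.1 q.2}))

theorem measurableSet_sameResidue (N M : ℕ) : MeasurableSet (sameResidue N M) :=
  measurableSet_of_cellIndex M fun a b => ∀ d, (a d : ZMod N) = b d

theorem measurableSet_sameCell (M : ℕ) : MeasurableSet (sameCell M) :=
  measurableSet_of_cellIndex M fun a b => a = b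

/-- The shift of the second variable by `k` lattice cells. -/
noncomputable def residueShift (N M : ℕ) (k : Fin 3 → ZMod N) : E³ × E³ :=
  (0, (1 / (M : ℝ)) • WithLp.toLp 2 fun d => ((k d).val : ℝ))

theorem residueShift_add_mem_sameResidue_iff {N M : ℕ} [NeZero N] (hM : 0 < M)
    (k : Fin 3 → ZMod N) (p : E³ × E³) :
    residueShift N M k + p ∈ sameResidue N M ↔
      k = fun d => (cellIndex M p.1 d : ZMod N) - cellIndex M p.2 d := by
  have hM' : (M : ℝ) ≠ 0 := by positivity
  have hcell : ∀ d, cellIndex M (residueShift N M k + p).2 d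
      = (k d).val + cellIndex M p.2 d := by
    intro d
    have : (M : ℝ) * (residueShift N M k + p).2 d = ((k d).val : ℤ) + (M : ℝ) * p.2 d := by
      simp [residueShift]
      field_simp
    rw [cellIndex, this, Int.floor_intCast_add, cellIndex]
  simp only [sameResidue, Set.mem_ofPred_eq, hcell, funext_iff]
  refine forall_congr' fun d => ?_
  simp [residueShift, eq_sub_iff_add_eq, eq_comm]

theorem sum_indicator_sameResidue_residueShift {N M : ℕ} [NeZero N] (hM : 0 < M) (p : E³ × E³) :
    ∑ k, (sameResidue N M).indicator (1 : E³ × E³ → ℝ) (residueShift N M k + p) = 1 := by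
  simp [Set.indicator_apply, residueShift_add_mem_sameResidue_iff hM]

theorem tendsto_residueShift (N : ℕ) {M : ℕ → ℕ} (hM : Tendsto M atTop atTop)
    (k : Fin 3 → ZMod N) : Tendsto (fun m => residueShift N (M m) k) atTop (𝓝 0) := by
  have h : Tendsto (fun m => 1 / (M m : ℝ)) atTop (𝓝 0) :=
    tendsto_one_div_atTop_nhds_zero_nat.comp hM
  refine Tendsto.prodMk_nhds tendsto_const_nhds ?_
  simpa using h.smul_const (WithLp.toLp 2 fun d => ((k d).val : ℝ) : E³)

theorem norm_indicator_one_le {α : Type*} (s : Set α) (p : α) :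
    ‖s.indicator (1 : α → ℝ) p‖ ≤ 1 := by
  simpa using norm_indicator_le_norm_self (s := s) (1 : α → ℝ) p

theorem tendsto_integral_sameResidue {N : ℕ} [NeZero N] {M : ℕ → ℕ} (hM_pos : ∀ m, 0 < M m)
    (hM : Tendsto M atTop atTop) {f : E³ × E³ → ℝ} (hf : Integrable f) :
    Tendsto (fun m => ∫ p, (sameResidue N (M m)).indicator 1 p * f p) atTop
      (𝓝 (1 / (N : ℝ) ^ 3 * ∫ p, f p)) := by
  have : (volume : Measure (E³ × E³)).IsAddLeftInvariant :=
    inferInstanceAs ((volume : Measure E³).prod volume).IsAddLeftInvariant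
  have := tendsto_integral_mul_of_sum_translate_eq_one
    (g := fun m => (sameResidue N (M m)).indicator (1 : E³ × E³ → ℝ))
    (fun m => measurable_one.indicator (measurableSet_sameResidue N (M m)))
    (fun m => norm_indicator_one_le _) (tendsto_residueShift N hM)
    (fun m => sum_indicator_sameResidue_residueShift (hM_pos m)) hf
  simpa [ZMod.card] using this

theorem ae_fst_ne_snd : ∀ᵐ p : E³ × E³, p.1 ≠ p.2 := by
  have hs : MeasurableSet {p : E³ × E³ | p.1 = p.2} :=
    measurableSet_eq_fun measurable_fst measurable_snd
  have : (volume : Measure (E³ × E³)) {p | p.1 = p.2} = 0 := by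
    rw [Measure.volume_eq_prod, Measure.measure_prod_null hs]
    refine ae_of_all _ fun a => ?_
    have : Prod.mk a ⁻¹' {p : E³ × E³ | p.1 = p.2} = {a} := by
      ext b
      simp [eq_comm]
    simp [this]
  simpa [ae_iff] using this

theorem eventually_notMem_sameCell {M : ℕ → ℕ} (hM : Tendsto M atTop atTop) {p : E³ × E³}
    (hp : p.1 ≠ p.2) : ∀ᶠ m in atTop, p ∉ sameCell (M m) := by
  obtain ⟨d, hd⟩ : ∃ d, p.1 d ≠ p.2 d := by
    by_contra! h
    exact hp (by ext d; exact h d)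
  have hpos : 0 < |p.1 d - p.2 d| := abs_pos.mpr (sub_ne_zero.mpr hd)
  have h := ((tendsto_natCast_atTop_atTop (R := ℝ)).comp hM).eventually_ge_atTop
    (1 / |p.1 d - p.2 d|)
  filter_upwards [h] with m hm hmem
  have hlt := Int.abs_sub_lt_one_of_floor_eq_floor (congrFun hmem d)
  rw [← mul_sub, abs_mul, Nat.abs_cast] at hlt
  rw [Function.comp_apply, div_le_iff₀ hpos] at hm
  linarith

theorem tendsto_integral_sameCell {M : ℕ → ℕ} (hM : Tendsto M atTop atTop)
    {f : E³ × E³ → ℝ} (hf : Integrable f) :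
    Tendsto (fun m => ∫ p, (sameCell (M m)).indicator 1 p * f p) atTop (𝓝 0) := by
  rw [← integral_zero (E³ × E³) ℝ]
  refine tendsto_integral_of_dominated_convergence (fun p => ‖f p‖) (fun m => ?_) hf.norm
    (fun m => ae_of_all _ fun p => ?_) ?_
  · exact (measurable_one.indicator (measurableSet_sameCell _)).aestronglyMeasurable.mul hf.1
  · rw [norm_mul]
    exact mul_le_of_le_one_left (norm_nonneg _) (norm_indicator_one_le _ p)
  · filter_upwards [ae_fst_ne_snd] with p hp
    refine tendsto_const_nhds.congr' ?_
    filter_upwards [eventually_notMem_sameCell hM hp] with m hm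
    simp [hm]

theorem ae_forall_mul_ne_intCast {M : ℕ} (hM : 0 < M) :
    ∀ᵐ x : E³, ∀ d, ∀ n : ℤ, (M : ℝ) * x d ≠ n := by
  have hM' : (M : ℝ) ≠ 0 := by positivity
  rw [ae_all_iff]
  intro d
  rw [ae_all_iff]
  intro n
  have hq : Measure.QuasiMeasurePreserving (fun x : E³ => x d) volume volume :=
    (Measure.quasiMeasurePreserving_eval (fun _ : Fin 3 => (volume : Measure ℝ)) d).comp
      (PiLp.volume_preserving_ofLp (Fin 3)).quasiMeasurePreserving
  have h : ∀ᵐ t : ℝ, t ≠ n / M := Measure.ae_ne volume _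
  filter_upwards [hq.ae h] with x hx hxn
  exact hx (by rw [← hxn]; field_simp)

/-- The open lattice cell with index `v`. -/
def openCell (M : ℕ) (v : Fin 3 → Fin M) : Set E³ :=
  {x | ∀ d, (v d : ℝ) * (1 / (M : ℝ)) < x d ∧ x d < ((v d : ℝ) + 1) * (1 / (M : ℝ))}

/-- Away from the cell faces, a point lies in exactly the open cell given by its index. -/
theorem exists_forall_mem_openCell_iff {M : ℕ} (hM : 0 < M) {x : E³}
    (hx : ∀ d, x d ∈ Set.Ioo (0 : ℝ) 1) (hx' : ∀ d, ∀ n : ℤ, (M : ℝ) * x d ≠ n) :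
    ∃ v : Fin 3 → Fin M, (∀ d, ((v d : ℕ) : ℤ) = cellIndex M x d) ∧
      ∀ w, x ∈ openCell M w ↔ w = v := by
  have hM' : (0 : ℝ) < M := by positivity
  have hex : ∀ d, ∃ i : Fin M, ((i : ℕ) : ℤ) = cellIndex M x d := by
    intro d
    have h0 : 0 ≤ cellIndex M x d := Int.floor_nonneg.mpr (mul_nonneg hM'.le (hx d).1.le)
    have h1 : cellIndex M x d < M := by
      rw [cellIndex, Int.floor_lt]
      have := (hx d).2
      push_cast
      nlinarith
    exact ⟨⟨(cellIndex M x d).toNat, by omega⟩, by simpa using h0⟩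
  choose v hv using hex
  refine ⟨v, hv, fun w => ?_⟩
  have hmem : x ∈ openCell M w ↔ ∀ d, cellIndex M x d = ((w d : ℕ) : ℤ) := by
    refine forall_congr' fun d => ?_
    rw [cellIndex, Int.floor_eq_iff, mul_one_div, mul_one_div, div_lt_iff₀ hM', lt_div_iff₀ hM',
      mul_comm (x d)]
    push_cast
    have := hx' d (w d : ℕ)
    push_cast at this
    exact and_congr_left fun _ => ⟨le_of_lt, fun h => lt_of_le_of_ne h this.symm⟩
  rw [hmem, funext_iff]
  refine forall_congr' fun d => ?_
  rw [← hv d, Fin.ext_iff]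
  omega

/-- Interacting cells are those that are distinct and congruent modulo `N`. -/
theorem exists_ne_zero_center_sub_iff {N M : ℕ} (hN : N ≠ 0) (hM : 0 < M) (a b : Fin 3 → ℤ) :
    (∃ z : Fin 3 → ℤ, z ≠ 0 ∧ ∀ d, ((a d : ℝ) + 1 / 2) * (1 / (M : ℝ)) -
      ((b d : ℝ) + 1 / 2) * (1 / (M : ℝ)) = (N : ℝ) * (1 / (M : ℝ)) * (z d : ℝ)) ↔
      (∀ d, (a d : ZMod N) = b d) ∧ a ≠ b := by
  have hM' : (M : ℝ) ≠ 0 := by positivity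
  have hd : ∀ (z : Fin 3 → ℤ) d, ((a d : ℝ) + 1 / 2) * (1 / (M : ℝ)) -
      ((b d : ℝ) + 1 / 2) * (1 / (M : ℝ)) = (N : ℝ) * (1 / (M : ℝ)) * (z d : ℝ) ↔
      a d - b d = N * z d := by
    intro z d
    rw [← @Int.cast_inj ℝ]
    push_cast
    field_simp
    constructor <;> intro h <;> linarith
  simp only [hd]
  constructor
  · rintro ⟨z, hz, h⟩
    refine ⟨fun d => ?_, ?_⟩
    · have := congrArg (Int.cast : ℤ → ZMod N) (h d)
      simpa [sub_eq_zero] using this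
    · rintro rfl
      refine hz (funext fun d => ?_)
      simpa [hN] using h d
  · rintro ⟨h, hab⟩
    have : ∀ d, ∃ z : ℤ, a d - b d = N * z := fun d =>
      (ZMod.intCast_eq_intCast_iff_dvd_sub _ _ N).mp (h d).symm
    choose z hz using this
    refine ⟨z, ?_, hz⟩
    rintro rfl
    refine hab (funext fun d => ?_)
    simpa [sub_eq_zero] using hz d

/-- For the unit cube `Ω = (0,1)³` partitioned into `M_m³` subcubes of side
`ε_m = 1/M_m` (with `N ∣ M_m`, `M_m → ∞`), where each subcube interacts with the subcubes
whose centers differ by a nonzero vector in `Nε_m ℤ³`, the pair-distribution functions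
`φ_m(x,y) = Σ_{i,j} A^{ij} 1_{Q_i}(x) 1_{Q_j}(y)` converge weak-* in `L∞(Ω×Ω)` to the
constant `1/N³`. -/
theorem periodic_lattice_pair_distribution_weakStar_limit
    (N : ℕ) (hN : 2 ≤ N)
    (Ω : Set (EuclideanSpace ℝ (Fin 3)))
    (hΩ : Ω = {x : EuclideanSpace ℝ (Fin 3) | ∀ d, x d ∈ Set.Ioo (0 : ℝ) 1})
    (M : ℕ → ℕ) (hM_pos : ∀ m, 0 < M m) (hM_dvd : ∀ m, N ∣ M m)
    (hM_tendsto : Tendsto M atTop atTop)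
    (ε : ℕ → ℝ) (hε : ∀ m, ε m = 1 / (M m : ℝ))
    (Q : ∀ m : ℕ, (Fin 3 → Fin (M m)) → Set (EuclideanSpace ℝ (Fin 3)))
    (hQ : ∀ m v, Q m v = {x : EuclideanSpace ℝ (Fin 3) |
      ∀ d, (v d : ℝ) * ε m < x d ∧ x d < ((v d : ℝ) + 1) * ε m})
    (x : ∀ m : ℕ, (Fin 3 → Fin (M m)) → EuclideanSpace ℝ (Fin 3))
    (hx : ∀ m v d, x m v d = ((v d : ℝ) + 1 / 2) * ε m)
    (A : ∀ m : ℕ, (Fin 3 → Fin (M m)) → (Fin 3 → Fin (M m)) → ℝ)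
    (hA : ∀ m v w, A m v w =
      if ∃ z : Fin 3 → ℤ, z ≠ 0 ∧ ∀ d, x m v d - x m w d = (N : ℝ) * ε m * (z d : ℝ)
      then 1 else 0)
    (φ : ℕ → EuclideanSpace ℝ (Fin 3) × EuclideanSpace ℝ (Fin 3) → ℝ)
    (hφ : ∀ m p, φ m p = ∑ v : Fin 3 → Fin (M m), ∑ w : Fin 3 → Fin (M m),
      A m v w * Set.indicator (Q m v) (fun _ => (1 : ℝ)) p.1 *
        Set.indicator (Q m w) (fun _ => (1 : ℝ)) p.2) :
    ∀ f : EuclideanSpace ℝ (Fin 3) × EuclideanSpace ℝ (Fin 3) → ℝ,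
      Integrable f (volume.restrict (Ω ×ˢ Ω)) →
      Tendsto (fun m => ∫ p in Ω ×ˢ Ω, φ m p * f p)
        atTop (𝓝 ((1 / (N : ℝ) ^ 3) * ∫ p in Ω ×ˢ Ω, f p)) := by
  intro f hf
  have hN0 : N ≠ 0 := by omega
  have : NeZero N := ⟨hN0⟩
  obtain rfl : ε = fun m => 1 / (M m : ℝ) := funext hε
  have hΩm : MeasurableSet (Ω ×ˢ Ω) := by
    have : MeasurableSet Ω := by
      rw [hΩ, Set.ofPred_forall]
      exact MeasurableSet.iInter fun d =>
        measurableSet_Ioo.preimage (by fun_prop : Measurable fun x : E³ => x d)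
    exact this.prod this
  have hF : Integrable ((Ω ×ˢ Ω).indicator f) := (integrable_indicator_iff hΩm).mpr hf
  have hφ_ae : ∀ m, ∀ᵐ p : E³ × E³, p ∈ Ω ×ˢ Ω →
      φ m p = (sameResidue N (M m)).indicator 1 p - (sameCell (M m)).indicator 1 p := by
    intro m
    have hface := ae_forall_mul_ne_intCast (hM_pos m)
    filter_upwards [Measure.quasiMeasurePreserving_fst.ae hface,
      Measure.quasiMeasurePreserving_snd.ae hface] with p hp₁ hp₂ hp
    subst hΩ
    obtain ⟨v, hv, hvmem⟩ := exists_forall_mem_openCell_iff (hM_pos m) hp.1 hp₁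
    obtain ⟨w, hw, hwmem⟩ := exists_forall_mem_openCell_iff (hM_pos m) hp.2 hp₂
    have hQ' : ∀ u, Q m u = openCell (M m) u := hQ m
    have hφA : φ m p = A m v w := by
      simp [hφ, hQ', Set.indicator_apply, hvmem, hwmem]
    have hcenter : ∀ u d, x m u d = ((((u d : ℕ) : ℤ) : ℝ) + 1 / 2) * (1 / (M m : ℝ)) := by
      simpa using hx m
    have hA' : A m v w =
        if p ∈ sameResidue N (M m) ∧ p ∉ sameCell (M m) then 1 else 0 := by
      rw [hA]
      simp only [hcenter, hv, hw]
      exact if_congr (exists_ne_zero_center_sub_iff hN0 (hM_pos m) _ _) rfl rfl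
    have hsub : p ∈ sameCell (M m) → p ∈ sameResidue N (M m) := fun h d =>
      congrArg Int.cast (congrFun h d)
    rw [hφA, hA']
    by_cases hcell : p ∈ sameCell (M m)
    · simp [hcell, hsub hcell]
    · simp [hcell, Set.indicator_apply]
  have hint : ∀ m, ∫ p in Ω ×ˢ Ω, φ m p * f p
      = (∫ p, (sameResidue N (M m)).indicator 1 p * (Ω ×ˢ Ω).indicator f p)
        - ∫ p, (sameCell (M m)).indicator 1 p * (Ω ×ˢ Ω).indicator f p := by
    intro m
    have hmul : ∀ s : Set (E³ × E³), MeasurableSet s →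
        Integrable fun p => s.indicator 1 p * (Ω ×ˢ Ω).indicator f p := fun s hs =>
      hF.bdd_mul (measurable_one.indicator hs).aestronglyMeasurable
        (ae_of_all _ (norm_indicator_one_le s))
    rw [← integral_sub (hmul _ (measurableSet_sameResidue _ _)) (hmul _ (measurableSet_sameCell _)),
      ← integral_indicator hΩm]
    refine integral_congr_ae ?_
    filter_upwards [hφ_ae m] with p hp
    by_cases hpΩ : p ∈ Ω ×ˢ Ω
    · simp only [Set.indicator_of_mem hpΩ, hp hpΩ, sub_mul]
    · simp only [Set.indicator_of_notMem hpΩ, mul_zero, sub_zero]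
  have hlim := (tendsto_integral_sameResidue (N := N) hM_pos hM_tendsto hF).sub
    (tendsto_integral_sameCell hM_tendsto hF)
  simp only [hint]
  rwa [sub_zero, integral_indicator hΩm] at hlim
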